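/- arXiv:2103.11607 — 2 statements merged into one kernel-verified Lean document; each statement's English description precedes it below -/
import Mathlib

section
/- For every p ∈ (0,1), the function K is differentiable at p with derivative K'(p) = E(p)/((1−p²)·p) − K(p)/p. -/
/-- Complete elliptic integral of the first kind. -/
noncomputable def ellipticK (p : ℝ) : ℝ :=
  ∫ z in (0:ℝ)..1, 1 / (Real.sqrt (1 - z ^ 2) * Real.sqrt (1 - p ^ 2 * z ^ 2))

/-- Complete elliptic integral of the second kind. -/
noncomputable def ellipticE (p : ℝ) : ℝ :=
  ∫ z in (0:ℝ)..1, Real.sqrt (1 - p ^ 2 * z ^ 2) / Real.sqrt (1 - z ^ 2)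

open MeasureTheory Set

theorem intervalIntegrable_one_div_sqrt_one_sub_sq :
    IntervalIntegrable (fun z : ℝ => 1 / √(1 - z ^ 2)) volume 0 1 := by
  apply intervalIntegral.intervalIntegrable_deriv_of_nonneg (g := Real.arcsin)
  · exact Real.continuous_arcsin.continuousOn
  · intro z hz
    norm_num at hz
    exact Real.hasDerivAt_arcsin (by linarith) (by linarith)
  · intro z _
    positivity

theorem one_sub_sq_mul_sq_pos {p z : ℝ} (hp : 0 ≤ p) (hp1 : p < 1) (hz : z ∈ Icc (0 : ℝ) 1) :
    0 < 1 - p ^ 2 * z ^ 2 := by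
  have hp2 : p ^ 2 < 1 := by nlinarith
  have hz2 : z ^ 2 ≤ 1 := by nlinarith [hz.1, hz.2]
  nlinarith [sq_nonneg p]

theorem continuousOn_sqrt_one_sub_sq_mul_sq (p : ℝ) (s : Set ℝ) :
    ContinuousOn (fun z : ℝ => √(1 - p ^ 2 * z ^ 2)) s := by
  fun_prop

theorem intervalIntegrable_ellipticK_integrand {p : ℝ} (hp : 0 ≤ p) (hp1 : p < 1) :
    IntervalIntegrable (fun z : ℝ => 1 / (√(1 - z ^ 2) * √(1 - p ^ 2 * z ^ 2))) volume 0 1 := by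
  have hcont : ContinuousOn (fun z : ℝ => (√(1 - p ^ 2 * z ^ 2))⁻¹) (uIcc 0 1) := by
    refine (continuousOn_sqrt_one_sub_sq_mul_sq p _).inv₀ fun z hz => ?_
    rw [uIcc_of_le zero_le_one] at hz
    exact (Real.sqrt_pos.2 (one_sub_sq_mul_sq_pos hp hp1 hz)).ne'
  refine (intervalIntegrable_one_div_sqrt_one_sub_sq.mul_continuousOn hcont).congr ?_
  intro z _
  simp [mul_comm]

theorem intervalIntegrable_ellipticE_integrand (p : ℝ) :
    IntervalIntegrable (fun z : ℝ => √(1 - p ^ 2 * z ^ 2) / √(1 - z ^ 2)) volume 0 1 := by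
  refine (intervalIntegrable_one_div_sqrt_one_sub_sq.mul_continuousOn
    (continuousOn_sqrt_one_sub_sq_mul_sq p _)).congr ?_
  intro z _
  simp only
  ring

theorem hasDerivAt_ellipticK_integrand {p z : ℝ} (h : 0 < 1 - p ^ 2 * z ^ 2) :
    HasDerivAt (fun x : ℝ => 1 / (√(1 - z ^ 2) * √(1 - x ^ 2 * z ^ 2)))
      (p * z ^ 2 / (√(1 - z ^ 2) * √(1 - p ^ 2 * z ^ 2) ^ 3)) p := by
  have hd : 0 < √(1 - p ^ 2 * z ^ 2) := Real.sqrt_pos.2 h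
  have hpoly : HasDerivAt (fun x : ℝ => 1 - x ^ 2 * z ^ 2) (-(2 * p * z ^ 2)) p := by
    simpa using ((hasDerivAt_pow 2 p).mul_const (z ^ 2)).const_sub 1
  have hinv := ((hpoly.sqrt h.ne').inv hd.ne').const_mul ((√(1 - z ^ 2))⁻¹)
  refine (hinv.congr_deriv ?_).congr_of_eventuallyEq (.of_forall fun x => ?_)
  · rcases eq_or_ne (√(1 - z ^ 2)) 0 with hw | hw
    · simp [hw]
    · field_simp
  · simp [mul_comm]

theorem hasDerivAt_mul_sqrt_div_sqrt {p z : ℝ} (hz : 0 < 1 - z ^ 2)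
    (h : 0 < 1 - p ^ 2 * z ^ 2) :
    HasDerivAt (fun y : ℝ => y * √(1 - y ^ 2) / √(1 - p ^ 2 * y ^ 2))
      ((1 - 2 * z ^ 2 + p ^ 2 * z ^ 4) / (√(1 - z ^ 2) * √(1 - p ^ 2 * z ^ 2) ^ 3)) z := by
  have hw : 0 < √(1 - z ^ 2) := Real.sqrt_pos.2 hz
  have hd : 0 < √(1 - p ^ 2 * z ^ 2) := Real.sqrt_pos.2 h
  have hpoly : HasDerivAt (fun y : ℝ => 1 - y ^ 2) (-(2 * z)) z := by
    simpa using (hasDerivAt_pow 2 z).const_sub 1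
  have hpoly' : HasDerivAt (fun y : ℝ => 1 - p ^ 2 * y ^ 2) (-(p ^ 2 * (2 * z))) z := by
    simpa using ((hasDerivAt_pow 2 z).const_mul (p ^ 2)).const_sub 1
  refine (((hasDerivAt_id z).mul (hpoly.sqrt hz.ne')).div
    (hpoly'.sqrt h.ne') hd.ne').congr_deriv ?_
  have hw2 : √(1 - z ^ 2) ^ 2 = 1 - z ^ 2 := Real.sq_sqrt hz.le
  have hd2 : √(1 - p ^ 2 * z ^ 2) ^ 2 = 1 - p ^ 2 * z ^ 2 := Real.sq_sqrt h.le
  simp only [id, Pi.mul_apply]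
  generalize √(1 - z ^ 2) = w at *
  generalize √(1 - p ^ 2 * z ^ 2) = d at *
  field_simp
  rw [hw2, hd2]
  ring

theorem deriv_ellipticK_integrand_eq {p z : ℝ} (hp : p ≠ 0) (hp1 : 1 - p ^ 2 ≠ 0)
    (h : 0 < 1 - p ^ 2 * z ^ 2) :
    p * z ^ 2 / (√(1 - z ^ 2) * √(1 - p ^ 2 * z ^ 2) ^ 3) =
      √(1 - p ^ 2 * z ^ 2) / √(1 - z ^ 2) / ((1 - p ^ 2) * p)
        - 1 / (√(1 - z ^ 2) * √(1 - p ^ 2 * z ^ 2)) / p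
        - p / (1 - p ^ 2) *
          ((1 - 2 * z ^ 2 + p ^ 2 * z ^ 4) / (√(1 - z ^ 2) * √(1 - p ^ 2 * z ^ 2) ^ 3)) := by
  have hd : 0 < √(1 - p ^ 2 * z ^ 2) := Real.sqrt_pos.2 h
  have hd2 : √(1 - p ^ 2 * z ^ 2) ^ 2 = 1 - p ^ 2 * z ^ 2 := Real.sq_sqrt h.le
  rcases eq_or_ne (√(1 - z ^ 2)) 0 with hw | hw
  · simp [hw]
  generalize √(1 - z ^ 2) = w at *
  generalize √(1 - p ^ 2 * z ^ 2) = d at *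
  field_simp
  rw [hd2]
  ring

theorem hasDerivAt_ellipticK_integral {p : ℝ} (hp : 0 < p) (hp1 : p < 1) :
    IntervalIntegrable (fun z : ℝ => p * z ^ 2 / (√(1 - z ^ 2) * √(1 - p ^ 2 * z ^ 2) ^ 3))
        volume 0 1 ∧
      HasDerivAt ellipticK
        (∫ z in (0 : ℝ)..1, p * z ^ 2 / (√(1 - z ^ 2) * √(1 - p ^ 2 * z ^ 2) ^ 3)) p := by
  obtain ⟨r, hpr, hr1⟩ := exists_between hp1
  have hr : 0 < 1 - r ^ 2 := by nlinarith
  refine intervalIntegral.hasDerivAt_integral_of_dominated_loc_of_deriv_le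
    (F := fun p z : ℝ => 1 / (√(1 - z ^ 2) * √(1 - p ^ 2 * z ^ 2)))
    (F' := fun p z : ℝ => p * z ^ 2 / (√(1 - z ^ 2) * √(1 - p ^ 2 * z ^ 2) ^ 3))
    (bound := fun z => 1 / √(1 - z ^ 2) * (1 / √(1 - r ^ 2) ^ 3))
    (Ioo_mem_nhds hp hpr) (.of_forall fun x => ?_)
    (intervalIntegrable_ellipticK_integrand hp.le hp1) ?_ (.of_forall fun z hz x hx => ?_)
    (intervalIntegrable_one_div_sqrt_one_sub_sq.mul_const _) (.of_forall fun z hz x hx => ?_)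
  · exact Measurable.aestronglyMeasurable (by fun_prop)
  · exact Measurable.aestronglyMeasurable (by fun_prop)
  · rw [uIoc_of_le zero_le_one] at hz
    have hz2 : z ^ 2 ≤ 1 := by nlinarith [hz.1, hz.2]
    have hx2 : x ^ 2 ≤ r ^ 2 := by nlinarith [hx.1, hx.2]
    have hle : 1 - r ^ 2 ≤ 1 - x ^ 2 * z ^ 2 := by nlinarith [sq_nonneg x]
    have hs : 0 < √(1 - r ^ 2) := Real.sqrt_pos.2 hr
    have hx0 := hx.1
    have hnum : x * z ^ 2 ≤ 1 := by nlinarith [hx.1, hx.2, sq_nonneg z]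
    rw [Real.norm_of_nonneg (by positivity)]
    calc x * z ^ 2 / (√(1 - z ^ 2) * √(1 - x ^ 2 * z ^ 2) ^ 3)
        = 1 / √(1 - z ^ 2) * (x * z ^ 2 / √(1 - x ^ 2 * z ^ 2) ^ 3) := by
          rw [div_mul_div_comm, one_mul]
      _ ≤ 1 / √(1 - z ^ 2) * (1 / √(1 - r ^ 2) ^ 3) := by gcongr
  · rw [uIoc_of_le zero_le_one] at hz
    exact hasDerivAt_ellipticK_integrand
      (one_sub_sq_mul_sq_pos hx.1.le (hx.2.trans hr1) (Ioc_subset_Icc_self hz))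

theorem hasDerivAt_ellipticK {p : ℝ} (hp : 0 < p) (hp1 : p < 1) :
    HasDerivAt ellipticK (ellipticE p / ((1 - p ^ 2) * p) - ellipticK p / p) p := by
  obtain ⟨hint, hderiv⟩ := hasDerivAt_ellipticK_integral hp hp1
  have hp2 : 0 < 1 - p ^ 2 := by nlinarith
  have hE := (intervalIntegrable_ellipticE_integrand p).div_const ((1 - p ^ 2) * p)
  have hK := (intervalIntegrable_ellipticK_integrand hp.le hp1).div_const p
  have hpos : ∀ z ∈ Icc (0 : ℝ) 1, 0 < 1 - p ^ 2 * z ^ 2 := fun z hz =>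
    one_sub_sq_mul_sq_pos hp.le hp1 hz
  set g : ℝ → ℝ := fun z =>
    p / (1 - p ^ 2) *
      ((1 - 2 * z ^ 2 + p ^ 2 * z ^ 4) / (√(1 - z ^ 2) * √(1 - p ^ 2 * z ^ 2) ^ 3)) with hg
  have hgint : IntervalIntegrable g volume 0 1 := by
    refine ((hE.sub hK).sub hint).congr fun z hz => ?_
    rw [uIoc_of_le zero_le_one] at hz
    have := deriv_ellipticK_integrand_eq hp.ne' hp2.ne' (hpos z (Ioc_subset_Icc_self hz))
    simp only [hg]
    linarith
  have hgzero : ∫ z in (0 : ℝ)..1, g z = 0 := by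
    rw [intervalIntegral.integral_eq_sub_of_hasDerivAt_of_le zero_le_one
      (f := fun z => p / (1 - p ^ 2) * (z * √(1 - z ^ 2) / √(1 - p ^ 2 * z ^ 2))) ?_ ?_ hgint]
    · simp
    · refine continuousOn_const.mul (ContinuousOn.div (by fun_prop) (by fun_prop) fun z hz => ?_)
      exact (Real.sqrt_pos.2 (hpos z hz)).ne'
    · intro z hz
      exact (hasDerivAt_mul_sqrt_div_sqrt (by nlinarith [hz.1, hz.2])
        (hpos z (Ioo_subset_Icc_self hz))).const_mul _
  convert hderiv using 1
  rw [intervalIntegral.integral_congr (g := fun z =>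
    √(1 - p ^ 2 * z ^ 2) / √(1 - z ^ 2) / ((1 - p ^ 2) * p)
      - 1 / (√(1 - z ^ 2) * √(1 - p ^ 2 * z ^ 2)) / p - g z),
    intervalIntegral.integral_sub (hE.sub hK) hgint, intervalIntegral.integral_sub hE hK,
    intervalIntegral.integral_div, intervalIntegral.integral_div, hgzero, sub_zero,
    ellipticE, ellipticK]
  intro z hz
  rw [uIcc_of_le zero_le_one] at hz
  exact deriv_ellipticK_integrand_eq hp.ne' hp2.ne' (hpos z hz)
end

section
/- The function φ(p) := E(p)/K(p) is strictly decreasing on (0,1); that is, for all p, q with 0 < p < q < 1 one has E(q)/K(q) < E(p)/K(p). Moreover its derivative satisfies φ'(p) < 0 for every p ∈ (0,1). -/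
open Set MeasureTheory Filter Topology

theorem intervalIntegrable_inv_sqrt_one_sub_sq :
    IntervalIntegrable (fun z : ℝ => (√(1 - z ^ 2))⁻¹) volume 0 1 := by
  refine intervalIntegral.intervalIntegrable_deriv_of_nonneg (g := Real.arcsin)
    Real.continuous_arcsin.continuousOn (fun z hz => ?_) fun z _ => by positivity
  rw [min_eq_left zero_le_one, max_eq_right zero_le_one] at hz
  simpa only [one_div] using
    Real.hasDerivAt_arcsin (by linarith [hz.1] : z ≠ -1) hz.2.ne

theorem sq_mul_sq_lt_one {p z : ℝ} (hp : |p| < 1) (hz : z ∈ Icc (0 : ℝ) 1) :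
    p ^ 2 * z ^ 2 < 1 := by
  have hp2 : p ^ 2 < 1 := (sq_lt_one_iff_abs_lt_one p).2 hp
  have hz2 : z ^ 2 ≤ 1 := pow_le_one₀ hz.1 hz.2
  nlinarith [sq_nonneg p]

theorem intervalIntegrable_weight_mul_comp {G : ℝ → ℝ} (hG : ContinuousOn G (Iio 1)) {p : ℝ}
    (hp : |p| < 1) :
    IntervalIntegrable (fun z : ℝ => (√(1 - z ^ 2))⁻¹ * G (p ^ 2 * z ^ 2)) volume 0 1 := by
  refine intervalIntegrable_inv_sqrt_one_sub_sq.mul_continuousOn ?_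
  rw [uIcc_of_le zero_le_one]
  exact hG.comp (by fun_prop) fun z hz => sq_mul_sq_lt_one hp hz

/-- Differentiation under the integral sign for integrals of the type of the complete elliptic
integrals, with respect to the modulus. -/
theorem hasDerivAt_integral_weight_mul_comp {G G' : ℝ → ℝ}
    (hG : ∀ u < 1, HasDerivAt G (G' u) u) (hG' : ContinuousOn G' (Iio 1)) {p : ℝ}
    (hp : |p| < 1) :
    IntervalIntegrable
        (fun z : ℝ => (√(1 - z ^ 2))⁻¹ * (G' (p ^ 2 * z ^ 2) * (2 * p * z ^ 2))) volume 0 1 ∧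
      HasDerivAt (fun p => ∫ z in (0 : ℝ)..1, (√(1 - z ^ 2))⁻¹ * G (p ^ 2 * z ^ 2))
        (∫ z in (0 : ℝ)..1, (√(1 - z ^ 2))⁻¹ * (G' (p ^ 2 * z ^ 2) * (2 * p * z ^ 2))) p := by
  have hGc : ContinuousOn G (Iio 1) := fun u hu => (hG u hu).continuousAt.continuousWithinAt
  obtain ⟨r, hpr, hr1⟩ := exists_between hp
  have hr0 : 0 ≤ r := (abs_nonneg p).trans hpr.le
  have hs : {x : ℝ | |x| < r} ∈ 𝓝 p := (isOpen_lt continuous_abs continuous_const).mem_nhds hpr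
  obtain ⟨C, hC⟩ := (isCompact_Icc (a := (0 : ℝ)) (b := r ^ 2)).exists_bound_of_continuousOn
    (hG'.mono fun u hu => hu.2.trans_lt (pow_lt_one₀ hr0 hr1 two_ne_zero))
  have hIoc : ∀ z ∈ uIoc (0 : ℝ) 1, z ∈ Icc (0 : ℝ) 1 := fun z hz => by
    rw [uIoc_of_le zero_le_one] at hz
    exact Ioc_subset_Icc_self hz
  refine intervalIntegral.hasDerivAt_integral_of_dominated_loc_of_deriv_le
    (F := fun p z => (√(1 - z ^ 2))⁻¹ * G (p ^ 2 * z ^ 2))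
    (F' := fun p z => (√(1 - z ^ 2))⁻¹ * (G' (p ^ 2 * z ^ 2) * (2 * p * z ^ 2)))
    (bound := fun z => (√(1 - z ^ 2))⁻¹ * (C * 2)) hs ?_
    (intervalIntegrable_weight_mul_comp hGc hp) ?_ ?_
    (intervalIntegrable_inv_sqrt_one_sub_sq.mul_const _) ?_
  · filter_upwards [hs] with x hx
    exact (intervalIntegrable_weight_mul_comp hGc (lt_trans hx hr1)).def'.aestronglyMeasurable
  · have h := (intervalIntegrable_weight_mul_comp hG' hp).mul_continuousOn
      (g := fun z => 2 * p * z ^ 2) (by fun_prop)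
    simpa only [mul_assoc] using h.def'.aestronglyMeasurable
  · refine ae_of_all _ fun z hz x hx => ?_
    have hz' := hIoc z hz
    have hx' : |x| < r := hx
    have hz2 : z ^ 2 ≤ 1 := pow_le_one₀ hz'.1 hz'.2
    have hxr : x ^ 2 ≤ r ^ 2 := sq_le_sq' (abs_lt.1 hx').1.le (abs_lt.1 hx').2.le
    have hbound := hC (x ^ 2 * z ^ 2) ⟨by positivity, by nlinarith [sq_nonneg x]⟩
    have hfactor : ‖2 * x * z ^ 2‖ ≤ 2 := by
      rw [norm_mul, norm_mul, Real.norm_eq_abs x, Real.norm_of_nonneg (sq_nonneg z),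
        Real.norm_two]
      nlinarith [abs_nonneg x, sq_nonneg z]
    rw [norm_mul, norm_mul, Real.norm_of_nonneg (by positivity : 0 ≤ (√(1 - z ^ 2))⁻¹)]
    have hC0 : 0 ≤ C := (norm_nonneg _).trans hbound
    gcongr
  · refine ae_of_all _ fun z hz x hx => ?_
    have hlt := sq_mul_sq_lt_one (lt_trans hx hr1) (hIoc z hz)
    have hinner : HasDerivAt (fun x : ℝ => x ^ 2 * z ^ 2) (2 * x * z ^ 2) x := by
      simpa using (hasDerivAt_pow 2 x).mul_const (z ^ 2)
    exact ((hG _ hlt).comp x hinner).const_mul _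

theorem hasDerivAt_sqrt_one_sub {u : ℝ} (hu : u < 1) :
    HasDerivAt (fun u => √(1 - u)) (-1 / (2 * √(1 - u))) u :=
  ((hasDerivAt_id u).const_sub 1).sqrt (sub_pos.2 hu).ne'

theorem hasDerivAt_inv_sqrt_one_sub {u : ℝ} (hu : u < 1) :
    HasDerivAt (fun u => (√(1 - u))⁻¹) (-(-1 / (2 * √(1 - u))) / √(1 - u) ^ 2) u :=
  (hasDerivAt_sqrt_one_sub hu).fun_inv (Real.sqrt_pos.2 (sub_pos.2 hu)).ne'

theorem ellipticK_eq (p : ℝ) :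
    ellipticK p = ∫ z in (0 : ℝ)..1, (√(1 - z ^ 2))⁻¹ * (√(1 - p ^ 2 * z ^ 2))⁻¹ := by
  simp only [ellipticK, one_div, mul_inv]

theorem ellipticE_eq (p : ℝ) :
    ellipticE p = ∫ z in (0 : ℝ)..1, (√(1 - z ^ 2))⁻¹ * √(1 - p ^ 2 * z ^ 2) := by
  simp only [ellipticE, div_eq_inv_mul]

theorem inv_sqrt_one_sub_sq_pos {z : ℝ} (hz : z ∈ Ioo (0 : ℝ) 1) : 0 < (√(1 - z ^ 2))⁻¹ :=
  inv_pos.2 (Real.sqrt_pos.2 (sub_pos.2 (pow_lt_one₀ hz.1.le hz.2 two_ne_zero)))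

theorem sqrt_one_sub_sq_mul_sq_pos {p z : ℝ} (hp : |p| < 1) (hz : z ∈ Ioo (0 : ℝ) 1) :
    0 < √(1 - p ^ 2 * z ^ 2) :=
  Real.sqrt_pos.2 (sub_pos.2 (sq_mul_sq_lt_one hp (Ioo_subset_Icc_self hz)))

theorem continuousOn_inv_sqrt_one_sub : ContinuousOn (fun u : ℝ => (√(1 - u))⁻¹) (Iio 1) :=
  fun _ hu => (hasDerivAt_inv_sqrt_one_sub hu).continuousAt.continuousWithinAt

theorem ellipticK_pos {p : ℝ} (hp : |p| < 1) : 0 < ellipticK p := by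
  rw [ellipticK_eq]
  refine intervalIntegral.intervalIntegral_pos_of_pos_on
    (intervalIntegrable_weight_mul_comp continuousOn_inv_sqrt_one_sub hp) (fun z hz => ?_) one_pos
  exact mul_pos (inv_sqrt_one_sub_sq_pos hz) (inv_pos.2 (sqrt_one_sub_sq_mul_sq_pos hp hz))

theorem ellipticE_nonneg (p : ℝ) : 0 ≤ ellipticE p :=
  intervalIntegral.integral_nonneg zero_le_one fun z _ => by positivity

theorem exists_pos_hasDerivAt_ellipticK {p : ℝ} (h0 : 0 < p) (h1 : p < 1) :
    ∃ k > 0, HasDerivAt ellipticK k p := by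
  have hp : |p| < 1 := by rwa [abs_of_pos h0]
  obtain ⟨hint, hderiv⟩ := hasDerivAt_integral_weight_mul_comp
    (fun u hu => hasDerivAt_inv_sqrt_one_sub hu)
    (fun u hu => by
      have hne : √(1 - u) ≠ 0 := (Real.sqrt_pos.2 (sub_pos.2 hu)).ne'
      exact ContinuousAt.continuousWithinAt (by fun_prop (disch := positivity))) hp
  refine ⟨_, intervalIntegral.intervalIntegral_pos_of_pos_on hint (fun z hz => ?_) one_pos,
    by rwa [← funext ellipticK_eq] at hderiv⟩
  have hw := inv_sqrt_one_sub_sq_pos hz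
  have hd := sqrt_one_sub_sq_mul_sq_pos hp hz
  have hz0 : 0 < z := hz.1
  rw [neg_div (2 * _), neg_neg]
  positivity

theorem exists_neg_hasDerivAt_ellipticE {p : ℝ} (h0 : 0 < p) (h1 : p < 1) :
    ∃ e < 0, HasDerivAt ellipticE e p := by
  have hp : |p| < 1 := by rwa [abs_of_pos h0]
  obtain ⟨hint, hderiv⟩ := hasDerivAt_integral_weight_mul_comp
    (fun u hu => hasDerivAt_sqrt_one_sub hu)
    (fun u hu => by
      have hne : √(1 - u) ≠ 0 := (Real.sqrt_pos.2 (sub_pos.2 hu)).ne'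
      exact ContinuousAt.continuousWithinAt (by fun_prop (disch := positivity))) hp
  refine ⟨_, ?_, by rwa [← funext ellipticE_eq] at hderiv⟩
  rw [← neg_pos, ← intervalIntegral.integral_neg]
  refine intervalIntegral.intervalIntegral_pos_of_pos_on hint.neg (fun z hz => ?_) one_pos
  have hw := inv_sqrt_one_sub_sq_pos hz
  have hd := sqrt_one_sub_sq_mul_sq_pos hp hz
  have hz0 : 0 < z := hz.1
  rw [neg_div, neg_mul, mul_neg, neg_neg]
  positivity

theorem exists_neg_hasDerivAt_ellipticE_div_ellipticK {p : ℝ} (h0 : 0 < p) (h1 : p < 1) :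
    ∃ d < 0, HasDerivAt (fun p => ellipticE p / ellipticK p) d p := by
  obtain ⟨k, hk, hK⟩ := exists_pos_hasDerivAt_ellipticK h0 h1
  obtain ⟨e, he, hE⟩ := exists_neg_hasDerivAt_ellipticE h0 h1
  have hKpos : 0 < ellipticK p := ellipticK_pos (by rwa [abs_of_pos h0])
  refine ⟨_, div_neg_of_neg_of_pos ?_ (pow_pos hKpos 2), hE.fun_div hK hKpos.ne'⟩
  nlinarith [mul_neg_of_neg_of_pos he hKpos, mul_nonneg (ellipticE_nonneg p) hk.le]

theorem ellipticRatio_strictAnti :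
    (∀ p q : ℝ, 0 < p → p < q → q < 1 →
      ellipticE q / ellipticK q < ellipticE p / ellipticK p) ∧
    (∀ p : ℝ, 0 < p → p < 1 →
      deriv (fun p => ellipticE p / ellipticK p) p < 0) := by
  have hderiv : ∀ p : ℝ, 0 < p → p < 1 →
      deriv (fun p => ellipticE p / ellipticK p) p < 0 := fun p h0 h1 => by
    obtain ⟨d, hd, h⟩ := exists_neg_hasDerivAt_ellipticE_div_ellipticK h0 h1
    rwa [h.deriv]
  refine ⟨fun p q hp hpq hq => ?_, hderiv⟩
  refine strictAntiOn_of_deriv_neg (f := fun p => ellipticE p / ellipticK p)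
    (convex_Ioo (0 : ℝ) 1) (fun x hx => ?_) (fun x hx => ?_)
    ⟨hp, hpq.trans hq⟩ ⟨hp.trans hpq, hq⟩ hpq
  · obtain ⟨d, -, h⟩ := exists_neg_hasDerivAt_ellipticE_div_ellipticK hx.1 hx.2
    exact h.continuousAt.continuousWithinAt
  · rw [interior_Ioo] at hx
    exact hderiv x hx.1 hx.2
end
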